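/- arXiv:1201.1733 — 2 statements merged into one kernel-verified Lean document; each statement's English description precedes it below -/
import Mathlib

section
/- Let K be a language over E = E₁ ∪ … ∪ Eₙ (n ≥ 2) and let E_k satisfy ∪_{i≠j}(Eᵢ ∩ Eⱼ) ⊆ E_k ⊆ E. Then P_{1+k}(K) ∥ P_{2+k}(K) ∥ … ∥ P_{n+k}(K) = (P_{1+k}(K) ∥ … ∥ P_{n+k}(K)) ∥ P_k(K); in particular, P_{1+k}(K) ∥ … ∥ P_{n+k}(K) ⊆ P_k⁻¹(P_k(K)). -/
/- Language-theoretic model of discrete-event systems: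
   strings over a finite alphabet (a `Finset` of symbols) are lists,
   natural projections erase letters outside the target alphabet,
   and the parallel composition is the standard synchronous composition. -/

namespace DES

variable {A : Type} [DecidableEq A]

/-- `star E` is `E*`: the set of finite strings over the alphabet `E`. -/
def star (E : Finset A) : Set (List A) :=
  {w | ∀ a ∈ w, a ∈ E}

/-- The natural projection onto `E₀`: it keeps letters of `E₀` and erases all
other letters. -/
def proj (E₀ : Finset A) (w : List A) : List A :=
  w.filter (· ∈ E₀)

/-- The inverse image `P⁻¹(L) = { s ∈ E* : P(s) ∈ L }` of the natural projection
from `E*` onto `E₀*`. -/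
def invProj (E E₀ : Finset A) (L : Set (List A)) : Set (List A) :=
  {s | s ∈ star E ∧ proj E₀ s ∈ L}

/-- Parallel composition `L₁ ∥ L₂ = P₁⁻¹(L₁) ∩ P₂⁻¹(L₂) ⊆ (E₁ ∪ E₂)*` of
`L₁ ⊆ E₁*` and `L₂ ⊆ E₂*`. -/
def par (E₁ E₂ : Finset A) (L₁ L₂ : Set (List A)) : Set (List A) :=
  invProj (E₁ ∪ E₂) E₁ L₁ ∩ invProj (E₁ ∪ E₂) E₂ L₂

/-- Parallel composition of a finite family `L i ⊆ (E i)*`. -/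
def parFam {ι : Type} [Fintype ι] (E : ι → Finset A) (L : ι → Set (List A)) :
    Set (List A) :=
  {w | w ∈ star (Finset.univ.sup E) ∧ ∀ i, proj (E i) w ∈ L i}

/-- The prefix closure of a language. -/
def pref (L : Set (List A)) : Set (List A) :=
  {w | ∃ u, w ++ u ∈ L}

/-- `K` is conditionally decomposable w.r.t. the alphabets `E i` and `Ek`:
`K = P_{1+k}(K) ∥ ⋯ ∥ P_{n+k}(K)`. -/
def condDecomp {ι : Type} [Fintype ι] (E : ι → Finset A) (Ek : Finset A)
    (K : Set (List A)) : Prop :=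
  K = parFam (fun i => E i ∪ Ek) (fun i => proj (E i ∪ Ek) '' K)

/-- Conditional decomposability for two components:
`K = P_{1+k}(K) ∥ P_{2+k}(K)`. -/
def condDecomp2 (E₁ E₂ Ek : Finset A) (K : Set (List A)) : Prop :=
  K = par (E₁ ∪ Ek) (E₂ ∪ Ek) (proj (E₁ ∪ Ek) '' K) (proj (E₂ ∪ Ek) '' K)

/-- The natural projection from `E'*` onto `E₀*` is an `L`-observer. -/
def observer (E' E₀ : Finset A) (L : Set (List A)) : Prop :=
  ∀ t ∈ proj E₀ '' L, ∀ s ∈ pref L, proj E₀ s <+: t →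
    ∃ u ∈ star E', s ++ u ∈ L ∧ proj E₀ (s ++ u) = t

/-- Letter-to-letter renaming map: letters in `Ekeep` are kept, all other
letters are renamed by `g`. -/
def ren (Ekeep : Finset A) (g : A → A) (w : List A) : List A :=
  w.map (fun a => if a ∈ Ekeep then a else g a)


theorem proj_proj_of_subset {A : Type} [DecidableEq A] {E₀ E₁ : Finset A} (h : E₀ ⊆ E₁)
    (w : List A) : proj E₀ (proj E₁ w) = proj E₀ w := by
  unfold proj
  rw [List.filter_filter]
  refine List.filter_congr fun a _ => ?_
  have := @h a
  by_cases h₀ : a ∈ E₀ <;> simp_all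

theorem proj_eq_self {A : Type} [DecidableEq A] {E : Finset A} {w : List A}
    (hw : w ∈ star E) : proj E w = w :=
  List.filter_eq_self.2 fun a ha => decide_eq_true (hw a ha)

theorem star_mono {A : Type} {E₀ E₁ : Finset A} (h : E₀ ⊆ E₁) : star E₀ ⊆ star E₁ :=
  fun _ hw a ha => h (hw a ha)

/-- `∥ᵢ P_{i+k}(K) = (∥ᵢ P_{i+k}(K)) ∥ P_k(K)`; in particular
`∥ᵢ P_{i+k}(K) ⊆ P_k⁻¹(P_k(K))`. -/
theorem stmt2 {A : Type} [DecidableEq A] {n : ℕ} (hn : 2 ≤ n)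
    (E : Fin n → Finset A) (Ek : Finset A)
    (hs : ∀ i j, i ≠ j → E i ∩ E j ⊆ Ek)
    (hkE : Ek ⊆ Finset.univ.sup E)
    (K : Set (List A)) (hK : K ⊆ star (Finset.univ.sup E)) :
    parFam (fun i => E i ∪ Ek) (fun i => proj (E i ∪ Ek) '' K) =
      par (Finset.univ.sup E) Ek
        (parFam (fun i => E i ∪ Ek) (fun i => proj (E i ∪ Ek) '' K))
        (proj Ek '' K) ∧
    parFam (fun i => E i ∪ Ek) (fun i => proj (E i ∪ Ek) '' K) ⊆
      invProj (Finset.univ.sup E) Ek (proj Ek '' K) := by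
  have hstar : parFam (fun i => E i ∪ Ek) (fun i => proj (E i ∪ Ek) '' K) ⊆
      star (Finset.univ.sup E) := fun w hw =>
    star_mono (Finset.sup_le fun i hi => Finset.union_subset (Finset.le_sup hi) hkE) hw.1
  have hsub : parFam (fun i => E i ∪ Ek) (fun i => proj (E i ∪ Ek) '' K) ⊆
      invProj (Finset.univ.sup E) Ek (proj Ek '' K) := by
    intro w hw
    obtain ⟨v, hv, hvw⟩ := hw.2 ⟨0, by omega⟩
    refine ⟨hstar hw, v, hv, ?_⟩
    rw [← proj_proj_of_subset Finset.subset_union_right v, hvw,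
      proj_proj_of_subset Finset.subset_union_right]
  refine ⟨?_, hsub⟩
  unfold par
  rw [Finset.union_eq_left.2 hkE]
  ext w
  constructor
  · intro hw
    exact ⟨⟨hstar hw, (proj_eq_self (hstar hw)).symm ▸ hw⟩, hsub hw⟩
  · rintro ⟨⟨hw, hp⟩, -⟩
    rwa [proj_eq_self hw] at hp

end DES
end

section
/- Let E₁, E₂, E_k be alphabets with E₁ ∩ E₂ ⊆ E_k ⊆ E := E₁ ∪ E₂, and let f_{1+k}, f_{2+k} be the renaming isomorphisms and P̃ the natural projection erasing the fresh (tilde) letters. Then for every language L ⊆ E*: P̃(f_{1+k}(L) ∥ f_{2+k}(L)) = P_{1+k}(L) ∥ P_{2+k}(L). -/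
/- Language-theoretic model of discrete-event systems:
   strings over a finite alphabet (a `Finset` of symbols) are lists,
   natural projections erase letters outside the target alphabet,
   and the parallel composition is the standard synchronous composition. -/

namespace DES

variable {A : Type} [DecidableEq A]

theorem proj_proj_of_inter {C D F : Finset A} (h : C ∩ D = F) (w : List A) :
    proj C (proj D w) = proj F w := by
  subst h
  simp [proj, List.filter_filter]

theorem proj_mem_star (C : Finset A) (w : List A) : proj C w ∈ star C := by
  simp [proj, star]

/-- Two strings with the same projection to the common alphabet can be interleaved. -/
theorem exists_merge (C D : Finset A) (x : List A) (hx : x ∈ star C) :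
    ∀ y ∈ star D, proj (C ∩ D) x = proj (C ∩ D) y →
      ∃ s ∈ star (C ∪ D), proj C s = x ∧ proj D s = y := by
  induction x with
  | nil =>
    intro y hy h
    simp only [proj, star, Set.mem_ofPred_eq, Finset.mem_inter, Finset.mem_union] at *
    refine ⟨y, fun a ha => Or.inr (hy a ha), ?_, ?_⟩
    · rw [List.filter_eq_nil_iff]
      have h' := List.filter_eq_nil_iff.mp h.symm
      intro a ha
      have := h' a ha
      have := hy a ha
      simp_all
    · rw [List.filter_eq_self]
      simpa using hy
  | cons a x ih =>
    have ha : a ∈ C := hx a (by simp)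
    have ih := ih fun b hb => hx b (by simp [hb])
    by_cases haD : a ∈ D
    · intro y
      induction y with
      | nil =>
        intro _ h
        simp [proj, ha, haD] at h
      | cons b y ihy =>
        intro hy h
        have hb : b ∈ D := hy b (by simp)
        have hy' : y ∈ star D := fun c hc => hy c (by simp [hc])
        by_cases hbC : b ∈ C
        · obtain ⟨rfl, h'⟩ : a = b ∧ proj (C ∩ D) x = proj (C ∩ D) y := by
            simpa [proj, ha, haD, hb, hbC] using h
          obtain ⟨s, hs, h1, h2⟩ := ih y hy' h'
          refine ⟨a :: s, ?_, ?_, ?_⟩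
          · simpa [star, ha] using hs
          · simpa [proj, ha] using h1
          · simpa [proj, haD] using h2
        · obtain ⟨s, hs, h1, h2⟩ := ihy hy' (by simpa [proj, hbC] using h)
          refine ⟨b :: s, ?_, ?_, ?_⟩
          · simpa [star, hb] using hs
          · simpa [proj, hbC] using h1
          · simpa [proj, hb] using h2
    · intro y hy h
      obtain ⟨s, hs, h1, h2⟩ := ih y hy (by simpa [proj, haD] using h)
      refine ⟨a :: s, ?_, ?_, ?_⟩
      · simpa [star, ha] using hs
      · simpa [proj, ha] using h1
      · simpa [proj, haD] using h2

/-- Renaming to letters outside the kept alphabet does not change the projection to it. -/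
theorem proj_ren {C : Finset A} {g : A → A} {w : List A}
    (h : ∀ a ∈ w, a ∉ C → g a ∉ C) : proj C (ren C g w) = proj C w := by
  induction w with
  | nil => rfl
  | cons a w ih =>
    have ih := ih fun b hb => h b (by simp [hb])
    have ha := h a (by simp)
    by_cases haC : a ∈ C
    · simpa [proj, ren, haC] using ih
    · simpa [proj, ren, haC, ha haC] using ih

theorem ren_mem_star {C T : Finset A} {g : A → A} {w : List A}
    (h : ∀ a ∈ w, a ∉ C → g a ∈ T) : ren C g w ∈ star (C ∪ T) := by
  intro b hb
  obtain ⟨a, ha, rfl⟩ := List.mem_map.mp hb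
  have := h a ha
  grind

/-- with `f_{1+k}, f_{2+k}` the renaming isomorphisms (letters of
`E_{i+k}` kept, letters of `E_j \ E_k` renamed to fresh tilde copies) and `P̃`
the projection erasing tilde letters,
`P̃(f_{1+k}(L) ∥ f_{2+k}(L)) = P_{1+k}(L) ∥ P_{2+k}(L)`. -/
theorem stmt4 {A : Type} [DecidableEq A] (E₁ E₂ Ek T₁ T₂ : Finset A)
    (hk1 : E₁ ∩ E₂ ⊆ Ek) (hk2 : Ek ⊆ E₁ ∪ E₂)
    (hT1 : Disjoint T₁ (E₁ ∪ E₂)) (hT2 : Disjoint T₂ (E₁ ∪ E₂))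
    (hT12 : Disjoint T₁ T₂)
    (g₁ g₂ : A → A)
    (hg₁ : Set.BijOn g₁ ↑(E₁ \ Ek) ↑T₁) (hg₂ : Set.BijOn g₂ ↑(E₂ \ Ek) ↑T₂)
    (L : Set (List A)) (hL : L ⊆ star (E₁ ∪ E₂)) :
    proj (E₁ ∪ E₂) ''
        par (E₁ ∪ Ek ∪ T₂) (E₂ ∪ Ek ∪ T₁)
          (ren (E₁ ∪ Ek) g₂ '' L) (ren (E₂ ∪ Ek) g₁ '' L) =
      par (E₁ ∪ Ek) (E₂ ∪ Ek) (proj (E₁ ∪ Ek) '' L) (proj (E₂ ∪ Ek) '' L) := by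
  have hgL₁ : ∀ v ∈ L, ∀ a ∈ v, a ∉ E₂ ∪ Ek → g₁ a ∈ T₁ := by
    intro v hv a ha hna
    have haE := hL hv a ha
    exact_mod_cast hg₁.mapsTo (show a ∈ ((E₁ \ Ek : Finset A) : Set A) by simp; grind)
  have hgL₂ : ∀ u ∈ L, ∀ a ∈ u, a ∉ E₁ ∪ Ek → g₂ a ∈ T₂ := by
    intro u hu a ha hna
    have haE := hL hu a ha
    exact_mod_cast hg₂.mapsTo (show a ∈ ((E₂ \ Ek : Finset A) : Set A) by simp; grind)
  rw [Finset.disjoint_left] at hT1 hT2 hT12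
  have hren₁ : ∀ v ∈ L, proj (E₂ ∪ Ek) (ren (E₂ ∪ Ek) g₁ v) = proj (E₂ ∪ Ek) v :=
    fun v hv => proj_ren fun a ha hna => by
      have := hT1 (hgL₁ v hv a ha hna)
      grind
  have hren₂ : ∀ u ∈ L, proj (E₁ ∪ Ek) (ren (E₁ ∪ Ek) g₂ u) = proj (E₁ ∪ Ek) u :=
    fun u hu => proj_ren fun a ha hna => by
      have := hT2 (hgL₂ u hu a ha hna)
      grind
  have hE : (E₁ ∪ Ek) ∪ (E₂ ∪ Ek) = E₁ ∪ E₂ := by grind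
  ext w
  constructor
  · rintro ⟨s, ⟨⟨-, u, hu, hus⟩, -, v, hv, hvs⟩, rfl⟩
    refine ⟨⟨hE ▸ proj_mem_star _ s, u, hu, ?_⟩, hE ▸ proj_mem_star _ s, v, hv, ?_⟩
    · rw [← hren₂ u hu, hus, proj_proj_of_inter (F := E₁ ∪ Ek) (by grind),
        proj_proj_of_inter (F := E₁ ∪ Ek) (by grind)]
    · rw [← hren₁ v hv, hvs, proj_proj_of_inter (F := E₂ ∪ Ek) (by grind),
        proj_proj_of_inter (F := E₂ ∪ Ek) (by grind)]
  · rintro ⟨⟨hw, u, hu, huw⟩, -, v, hv, hvw⟩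
    rw [hE] at hw
    have hi₁ : (E₁ ∪ E₂) ∩ (E₁ ∪ Ek ∪ T₂) = E₁ ∪ Ek := by grind
    have hi₂ : ((E₁ ∪ E₂) ∪ (E₁ ∪ Ek ∪ T₂)) ∩ (E₂ ∪ Ek ∪ T₁) = E₂ ∪ Ek := by grind
    obtain ⟨r, hr, hrw, hru⟩ := exists_merge _ _ w hw _ (ren_mem_star (hgL₂ u hu))
      (by rw [hi₁, hren₂ u hu, huw])
    obtain ⟨s, hs, hsr, hsv⟩ := exists_merge _ _ r hr _ (ren_mem_star (hgL₁ v hv)) (by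
      rw [hi₂, hren₁ v hv, hvw, ← hrw, proj_proj_of_inter (F := E₂ ∪ Ek) (by grind)])
    have hs' : s ∈ star ((E₁ ∪ Ek ∪ T₂) ∪ (E₂ ∪ Ek ∪ T₁)) := fun a ha => by
      have := hs a ha
      grind
    refine ⟨s, ⟨⟨hs', u, hu, ?_⟩, hs', v, hv, hsv.symm⟩, ?_⟩
    · rw [← hru, ← hsr, proj_proj_of_inter (F := E₁ ∪ Ek ∪ T₂) (by grind)]
    · rw [← hrw, ← hsr, proj_proj_of_inter (F := E₁ ∪ E₂) (by grind)]

end DES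
end
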